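/- arXiv:math/0608472 — 4 statements merged into one kernel-verified Lean document; each statement's English description precedes it below -/
import Mathlib

section
/- The 9×9 real matrix B₃ (a matrix representation of the map ev×j×a₁×a₂ near a flat cycle, for the non-degenerate type α₃) has determinant det B₃ = −δ(u,v₁)·δ(u,v₂)·n·((n²+n·m)·(δ(u,v₁)+δ(u,v₂)) + n·δ(v₁,v₂)). -/
/-- δ(x,y) = x₁y₂ − x₂y₁ for x, y ∈ ℝ². -/
def del (x y : ℝ × ℝ) : ℝ := x.1 * y.2 - x.2 * y.1

/-- The 9×9 matrix B₃: a matrix representation of ev×j×a₁×a₂ near a flat cycle,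
for the non-degenerate type α₃. -/
def B₃ (u v₁ v₂ : ℝ × ℝ) (n m : ℝ) : Matrix (Fin 9) (Fin 9) ℝ :=
  !![1, 0, 0,    0,    n*u.1, 0,     0,        0,           0;
     0, 1, 0,    0,    n*u.2, 0,     0,        0,           0;
     1, 0, v₁.1, 0,    0,     0,     0,        0,           0;
     0, 1, v₁.2, 0,    0,     0,     0,        0,           0;
     1, 0, 0,    v₂.1, n*u.1, n*u.1, 0,        0,           0;
     0, 1, 0,    v₂.2, n*u.2, n*u.2, 0,        0,           0;
     0, 0, 0,    0,    n*u.1, n*u.1, -(m*u.1), v₁.1+n*u.1,  -v₂.1+n*u.1;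
     0, 0, 0,    0,    n*u.2, n*u.2, -(m*u.2), v₁.2+n*u.2,  -v₂.2+n*u.2;
     0, 0, 0,    0,    1,     1,     1,        1,           1]

set_option maxHeartbeats 1000000 in
theorem det_B₃ (u v₁ v₂ : ℝ × ℝ) (n m : ℝ) :
    (B₃ u v₁ v₂ n m).det =
      -(del u v₁) * del u v₂ * n *
        ((n^2 + n*m) * (del u v₁ + del u v₂) + n * del v₁ v₂) := by
  unfold B₃ del
  simp [Matrix.det_succ_row_zero (n := 8), Fin.sum_univ_succ]
  simp [Matrix.det_succ_row_zero (n := 7), Fin.sum_univ_succ, Fin.succAbove]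
  simp [Matrix.det_succ_row_zero (n := 6), Fin.sum_univ_succ, Fin.succAbove]
  simp [Matrix.det_succ_row_zero (n := 5), Fin.sum_univ_succ, Fin.succAbove]
  simp [Matrix.det_succ_row_zero (n := 4), Fin.sum_univ_succ, Fin.succAbove]
  simp [Matrix.det_succ_row_zero (n := 3), Fin.sum_univ_succ, Fin.succAbove]
  simp [Matrix.det_fin_three, Fin.succAbove]
  ring
end

section
/- The 9×9 real matrix B₄ (a matrix representation of the map ev×j×a₁×a₂ near a flat cycle, for the non-degenerate type α₄) has determinant det B₄ = δ(u,v₁)·δ(u,v₂)·n·((m²+n·m)·(δ(u,v₁)+δ(u,v₂)) − n·δ(v₁,v₂)). -/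
/-- The 9×9 matrix B₄: a matrix representation of ev×j×a₁×a₂ near a flat cycle,
for the non-degenerate type α₄. -/
def B₄ (u v₁ v₂ : ℝ × ℝ) (n m : ℝ) : Matrix (Fin 9) (Fin 9) ℝ :=
  !![1, 0, 0,    0,    n*u.1, 0,     0,        -v₁.1-m*u.1, 0;
     0, 1, 0,    0,    n*u.2, 0,     0,        -v₁.2-m*u.2, 0;
     1, 0, v₁.1, 0,    0,     0,     0,        0,           0;
     0, 1, v₁.2, 0,    0,     0,     0,        0,           0;
     1, 0, 0,    v₂.1, n*u.1, n*u.1, 0,        -v₁.1-m*u.1, v₂.1-m*u.1;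
     0, 1, 0,    v₂.2, n*u.2, n*u.2, 0,        -v₁.2-m*u.2, v₂.2-m*u.2;
     0, 0, 0,    0,    n*u.1, n*u.1, -(m*u.1), -v₁.1-m*u.1, v₂.1-m*u.1;
     0, 0, 0,    0,    n*u.2, n*u.2, -(m*u.2), -v₁.2-m*u.2, v₂.2-m*u.2;
     0, 0, 0,    0,    1,     1,     1,        1,           1]

set_option maxHeartbeats 1000000 in
theorem det_B₄ (u v₁ v₂ : ℝ × ℝ) (n m : ℝ) :
    (B₄ u v₁ v₂ n m).det =
      del u v₁ * del u v₂ * n *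
        ((m^2 + n*m) * (del u v₁ + del u v₂) - n * del v₁ v₂) := by
  unfold B₄ del
  simp [Matrix.det_succ_column_zero (n := 8), Fin.sum_univ_succ]
  simp [Matrix.det_succ_column_zero (n := 7), Fin.sum_univ_succ, Fin.succAbove]
  simp [Matrix.det_succ_column_zero (n := 6), Fin.sum_univ_succ, Fin.succAbove]
  simp [Matrix.det_succ_column_zero (n := 5), Fin.sum_univ_succ, Fin.succAbove]
  simp [Matrix.det_succ_row_zero (n := 4), Fin.sum_univ_succ, Fin.succAbove]
  simp [Matrix.det_succ_row_zero (n := 3), Fin.sum_univ_succ, Fin.succAbove]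
  simp [Matrix.det_fin_three, Fin.succAbove]
  ring
end

section
/- The determinants of the local matrices for the four combinatorial types adjacent to a flat-cycle wall satisfy the linear relation δ(u,v₂)·det A₁ + δ(u,v₁)·det A₂ − det B₃ + det B₄ = 0. -/
/-- The 7×7 matrix A₁ (type α₁, flat cycle surviving on the e₂-side). -/
def A₁ (u v₁ v₂ : ℝ × ℝ) (n m : ℝ) : Matrix (Fin 7) (Fin 7) ℝ :=
  !![1, 0, 0,    0,    n*u.1, 0,       (n+m)*u.1;
     0, 1, 0,    0,    n*u.2, 0,       (n+m)*u.2;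
     1, 0, v₁.1, 0,    0,     0,       0;
     0, 1, v₁.2, 0,    0,     0,       0;
     1, 0, 0,    v₂.1, 0,     n*m*u.1, (n+m)*u.1;
     0, 1, 0,    v₂.2, 0,     n*m*u.2, (n+m)*u.2;
     0, 0, 0,    0,    0,     m+n,     0]

/-- The 7×7 matrix A₂ (type α₂, flat cycle surviving on the e₁-side): equal to A₁
except that the last entries of the first two rows are 0. -/
def A₂ (u v₁ v₂ : ℝ × ℝ) (n m : ℝ) : Matrix (Fin 7) (Fin 7) ℝ :=
  !![1, 0, 0,    0,    n*u.1, 0,       0;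
     0, 1, 0,    0,    n*u.2, 0,       0;
     1, 0, v₁.1, 0,    0,     0,       0;
     0, 1, v₁.2, 0,    0,     0,       0;
     1, 0, 0,    v₂.1, 0,     n*m*u.1, (n+m)*u.1;
     0, 1, 0,    v₂.2, 0,     n*m*u.2, (n+m)*u.2;
     0, 0, 0,    0,    0,     m+n,     0]

/-- A matrix whose leading block is the identity has the same determinant as the Schur
complement of that block. -/
theorem Matrix.det_eq_det_schur_of_leading_one {R : Type*} [CommRing R] {p k : ℕ}
    (M : Matrix (Fin (p + k)) (Fin (p + k)) R) (N : Matrix (Fin k) (Fin k) R)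
    (hM : ∀ i j, M (Fin.castAdd k i) (Fin.castAdd k j) = (1 : Matrix (Fin p) (Fin p) R) i j)
    (hN : ∀ i j, N i j = M (Fin.natAdd p i) (Fin.natAdd p j) -
      ∑ l, M (Fin.natAdd p i) (Fin.castAdd k l) * M (Fin.castAdd k l) (Fin.natAdd p j)) :
    M.det = N.det := by
  rw [← Matrix.det_submatrix_equiv_self (finSumFinEquiv (m := p) (n := k)) M,
    ← Matrix.fromBlocks_toBlocks (M.submatrix finSumFinEquiv finSumFinEquiv),
    show (M.submatrix finSumFinEquiv finSumFinEquiv).toBlocks₁₁ = 1 by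
      ext i j; simpa [Matrix.toBlocks₁₁] using hM i j,
    Matrix.det_fromBlocks_one₁₁]
  congr 1
  ext i j
  simp [hN, Matrix.mul_apply, Matrix.toBlocks₁₂, Matrix.toBlocks₂₁, Matrix.toBlocks₂₂]

theorem det_B₃_eq (u v₁ v₂ : ℝ × ℝ) (n m : ℝ) : (B₃ u v₁ v₂ n m).det =
    !![v₁.1, 0,    -(n*u.1), 0,     0,        0,          0;
       v₁.2, 0,    -(n*u.2), 0,     0,        0,          0;
       0,    v₂.1, 0,        n*u.1, 0,        0,          0;
       0,    v₂.2, 0,        n*u.2, 0,        0,          0;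
       0,    0,    n*u.1,    n*u.1, -(m*u.1), v₁.1+n*u.1, -v₂.1+n*u.1;
       0,    0,    n*u.2,    n*u.2, -(m*u.2), v₁.2+n*u.2, -v₂.2+n*u.2;
       0,    0,    1,        1,     1,        1,          1].det := by
  refine Matrix.det_eq_det_schur_of_leading_one (p := 2) (k := 7) _ _ ?_ ?_ <;>
  · intro i j
    fin_cases i <;> fin_cases j <;> simp [B₃, Fin.natAdd, Fin.castAdd, Fin.castLE]

theorem det_B₄_eq (u v₁ v₂ : ℝ × ℝ) (n m : ℝ) : (B₄ u v₁ v₂ n m).det =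
    !![v₁.1, 0,    -(n*u.1), 0,     0,        v₁.1+m*u.1,  0;
       v₁.2, 0,    -(n*u.2), 0,     0,        v₁.2+m*u.2,  0;
       0,    v₂.1, 0,        n*u.1, 0,        0,           v₂.1-m*u.1;
       0,    v₂.2, 0,        n*u.2, 0,        0,           v₂.2-m*u.2;
       0,    0,    n*u.1,    n*u.1, -(m*u.1), -v₁.1-m*u.1, v₂.1-m*u.1;
       0,    0,    n*u.2,    n*u.2, -(m*u.2), -v₁.2-m*u.2, v₂.2-m*u.2;
       0,    0,    1,        1,     1,        1,           1].det := by
  refine Matrix.det_eq_det_schur_of_leading_one (p := 2) (k := 7) _ _ ?_ ?_ <;>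
  · intro i j
    fin_cases i <;> fin_cases j <;>
      simp [B₄, Fin.natAdd, Fin.castAdd, Fin.castLE, add_comm]

set_option maxHeartbeats 4000000 in
theorem det_B₃_sub_det_B₄ (u v₁ v₂ : ℝ × ℝ) (n m : ℝ) :
    (B₃ u v₁ v₂ n m).det - (B₄ u v₁ v₂ n m).det =
      -(n * (n + m) ^ 2 * del u v₁ * del u v₂ * (del u v₁ + del u v₂)) := by
  rw [det_B₃_eq, det_B₄_eq]
  simp [del, Matrix.det_succ_column_zero, Fin.sum_univ_succ, Fin.succAbove]
  ring

set_option maxHeartbeats 1000000 in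
theorem det_A₁ (u v₁ v₂ : ℝ × ℝ) (n m : ℝ) :
    (A₁ u v₁ v₂ n m).det = -(n * (n + m) ^ 2 * del u v₁ * del u v₂) := by
  simp [A₁, del, Matrix.det_succ_column_zero, Fin.sum_univ_succ, Fin.succAbove]
  ring

set_option maxHeartbeats 1000000 in
theorem det_A₂ (u v₁ v₂ : ℝ × ℝ) (n m : ℝ) :
    (A₂ u v₁ v₂ n m).det = -(n * (n + m) ^ 2 * del u v₁ * del u v₂) := by
  simp [A₂, del, Matrix.det_succ_column_zero, Fin.sum_univ_succ, Fin.succAbove]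
  ring

/-- δ(u,v₂)·det A₁ + δ(u,v₁)·det A₂ − det B₃ + det B₄ = 0. -/
theorem wall_relation (u v₁ v₂ : ℝ × ℝ) (n m : ℝ) :
    del u v₂ * (A₁ u v₁ v₂ n m).det + del u v₁ * (A₂ u v₁ v₂ n m).det
      - (B₃ u v₁ v₂ n m).det + (B₄ u v₁ v₂ n m).det = 0 := by
  rw [det_A₁, det_A₂]
  linear_combination -det_B₃_sub_det_B₄ u v₁ v₂ n m
end

section
/- Assume n > 0, m > 0, δ(u,v₁) > 0, δ(u,v₂) > 0 and δ(v₁,v₂) ≥ 0. Then det A₁ < 0, det A₂ < 0 and det A₃ > 0 (so the types α₁, α₂ lie on one fixed side of the wall and α₃ on the other, as their existence is governed by the signs of these determinants). -/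
/-- M₁ = −δ(v₁,v₂) + n·δ(v₁,u) − n·δ(u,v₂). -/
def M₁ (u v₁ v₂ : ℝ × ℝ) (n : ℝ) : ℝ := -(del v₁ v₂) + n * del v₁ u - n * del u v₂

/-- M₂ = −n·δ(u,v₂). -/
def M₂ (u v₂ : ℝ × ℝ) (n : ℝ) : ℝ := -(n * del u v₂)

/-- M₃ = n·δ(u,v₁). -/
def M₃ (u v₁ : ℝ × ℝ) (n : ℝ) : ℝ := n * del u v₁

/-- w = −M₂·(−v₁−n·u) + M₃·(v₂−n·u) ∈ ℝ². -/
def wVec (u v₁ v₂ : ℝ × ℝ) (n : ℝ) : ℝ × ℝ :=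
  (-(M₂ u v₂ n)) • (-v₁ - n • u) + (M₃ u v₁ n) • (v₂ - n • u)

/-- The 7×7 matrix A₃ (type α₃, with respect to the chosen basis involving M₁, M₂, M₃). -/
def A₃ (u v₁ v₂ : ℝ × ℝ) (n m : ℝ) : Matrix (Fin 7) (Fin 7) ℝ :=
  !![1, 0, 0,    0,    n*u.1, 0,       0;
     0, 1, 0,    0,    n*u.2, 0,       0;
     1, 0, v₁.1, 0,    0,     0,       0;
     0, 1, v₁.2, 0,    0,     0,       0;
     1, 0, 0,    v₂.1, 0,     n*m*u.1, (wVec u v₁ v₂ n).1;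
     0, 1, 0,    v₂.2, 0,     n*m*u.2, (wVec u v₁ v₂ n).2;
     0, 0, 0,    0,    0,     m+n,     M₁ u v₁ v₂ n - M₂ u v₂ n + M₃ u v₁ n]

/-- The determinant shared by the shapes of `A₁`, `A₂` and `A₃`, with the nonconstant entries
of the last two columns left arbitrary. -/
theorem det_seven_eq (u v₁ v₂ p q : ℝ × ℝ) (n c d r : ℝ) :
    (!![1, 0, 0,    0,    n*u.1, 0,     p.1;
        0, 1, 0,    0,    n*u.2, 0,     p.2;
        1, 0, v₁.1, 0,    0,     0,     0;
        0, 1, v₁.2, 0,    0,     0,     0;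
        1, 0, 0,    v₂.1, 0,     c*u.1, q.1;
        0, 1, 0,    v₂.2, 0,     c*u.2, q.2;
        0, 0, 0,    0,    0,     d,     r] : Matrix (Fin 7) (Fin 7) ℝ).det =
      r * n * c * del u v₁ * del u v₂ - d * n * del u v₁ * del (q - p) v₂
        - d * n * del p v₁ * del u v₂ := by
  rw [Matrix.det_succ_row_zero]
  simp [Fin.sum_univ_succ]
  simp only [Matrix.det_succ_row_zero (n := 5)]
  simp [Fin.sum_univ_succ, Fin.succAbove]
  simp only [Matrix.det_succ_row_zero (n := 4)]
  simp [Fin.sum_univ_succ, Fin.succAbove]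
  simp only [Matrix.det_succ_row_zero (n := 3)]
  simp [Fin.sum_univ_succ, Fin.succAbove, Matrix.det_fin_three, del]
  ring

/-- Under the positivity assumptions, det A₁ < 0, det A₂ < 0 and det A₃ > 0, so the
types α₁, α₂ lie on one fixed side of the wall and α₃ on the other. -/
theorem det_signs (u v₁ v₂ : ℝ × ℝ) (n m : ℝ)
    (hn : 0 < n) (hm : 0 < m)
    (h₁ : 0 < del u v₁) (h₂ : 0 < del u v₂) (h₁₂ : 0 ≤ del v₁ v₂) :
    (A₁ u v₁ v₂ n m).det < 0 ∧ (A₂ u v₁ v₂ n m).det < 0 ∧ 0 < (A₃ u v₁ v₂ n m).det := by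
  have hA₁ : (A₁ u v₁ v₂ n m).det = -(n * (m + n) ^ 2 * (del u v₁ * del u v₂)) := by
    refine (det_seven_eq u v₁ v₂ ((n + m) • u) ((n + m) • u) n (n * m) (m + n) 0).trans ?_
    simp only [del, Prod.smul_fst, Prod.smul_snd, Prod.fst_sub, Prod.snd_sub, smul_eq_mul]
    ring
  have hA₂ : (A₂ u v₁ v₂ n m).det = -(n * (m + n) ^ 2 * (del u v₁ * del u v₂)) := by
    refine (det_seven_eq u v₁ v₂ 0 ((n + m) • u) n (n * m) (m + n) 0).trans ?_
    simp only [del, Prod.smul_fst, Prod.smul_snd, Prod.fst_sub, Prod.snd_sub, Prod.fst_zero,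
      Prod.snd_zero, smul_eq_mul]
    ring
  have hA₃ : (A₃ u v₁ v₂ n m).det = n ^ 3 * (del u v₁ * del u v₂) *
      (del v₁ v₂ + (m + n) * (del u v₁ + del u v₂)) := by
    refine (det_seven_eq u v₁ v₂ 0 (wVec u v₁ v₂ n) n (n * m) (m + n)
      (M₁ u v₁ v₂ n - M₂ u v₂ n + M₃ u v₁ n)).trans ?_
    simp only [del, wVec, M₁, M₂, M₃, Prod.smul_fst, Prod.smul_snd, Prod.fst_sub, Prod.snd_sub,
      Prod.fst_add, Prod.snd_add, Prod.fst_neg, Prod.snd_neg, Prod.fst_zero, Prod.snd_zero,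
      smul_eq_mul]
    ring
  rw [hA₁, hA₂, hA₃]
  exact ⟨neg_neg_of_pos (by positivity), neg_neg_of_pos (by positivity), by positivity⟩
end
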